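/- Let Φ: M_n(ℂ) → M_m(ℂ) be a trace-preserving completely positive map and Φ† its Hilbert–Schmidt adjoint. If A is in the multiplicative domain of Φ (i.e., Φ(A)Φ(Y) = Φ(AY) and Φ(Y)Φ(A) = Φ(YA) for all Y), then Φ†(Φ(A)) = A. -/

import Mathlib

open Matrix

/-- For a trace-preserving completely positive map `Φ(X) = ∑ᵢ Kᵢ X Kᵢ*` with
Hilbert–Schmidt adjoint `Φ†(Y) = ∑ᵢ Kᵢ* Y Kᵢ`: if `A` is in the multiplicative domain
of `Φ`, then `Φ†(Φ(A)) = A`. -/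
theorem adjoint_comp_fixes_multiplicativeDomain {n m p : ℕ}
    (K : Fin p → Matrix (Fin m) (Fin n) ℂ)
    (htp : ∑ i, (K i)ᴴ * K i = 1)
    (A : Matrix (Fin n) (Fin n) ℂ)
    (hA : ∀ Y : Matrix (Fin n) (Fin n) ℂ,
      (∑ i, K i * A * (K i)ᴴ) * (∑ i, K i * Y * (K i)ᴴ) = ∑ i, K i * (A * Y) * (K i)ᴴ ∧
      (∑ i, K i * Y * (K i)ᴴ) * (∑ i, K i * A * (K i)ᴴ) = ∑ i, K i * (Y * A) * (K i)ᴴ) :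
    ∑ i, (K i)ᴴ * (∑ j, K j * A * (K j)ᴴ) * K i = A := by
  have tr : ∀ X : Matrix (Fin n) (Fin n) ℂ,
      (∑ i, K i * X * (K i)ᴴ).trace = X.trace := by
    intro X
    have h1 : (∑ i, K i * X * (K i)ᴴ).trace = ((∑ i, (K i)ᴴ * K i) * X).trace := by
      rw [Finset.sum_mul, trace_sum, trace_sum]
      refine Finset.sum_congr rfl fun i _ => ?_
      rw [trace_mul_comm, Matrix.mul_assoc]
    rw [h1, htp, Matrix.one_mul]
  have adj : ∀ (Z : Matrix (Fin m) (Fin m) ℂ) (Y : Matrix (Fin n) (Fin n) ℂ),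
      ((∑ i, (K i)ᴴ * Z * K i) * Y).trace = (Z * ∑ i, K i * Y * (K i)ᴴ).trace := by
    intro Z Y
    rw [Finset.sum_mul, Finset.mul_sum, trace_sum, trace_sum]
    refine Finset.sum_congr rfl fun i _ => ?_
    rw [Matrix.mul_assoc, Matrix.mul_assoc, trace_mul_comm, Matrix.mul_assoc,
      Matrix.mul_assoc]
  refine Matrix.ext_iff_trace_mul_right.mpr fun Y => ?_
  rw [adj, (hA Y).1, tr]
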